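/- arXiv:1910.07802 — 9 statements merged into one kernel-verified Lean document; each statement's English description precedes it below -/
import Mathlib

section
/- Let Y be a noetherian topological space, let G be a group acting on Y by homeomorphisms, and let X be a dense open subset of Y. Then there exists a dense G-invariant open subset U of Y such that for any two points x, y ∈ U there exists g ∈ G with g • x ∈ X and g • y ∈ X. -/
open Pointwise

open TopologicalSpace Filter Topology

/-- An ultrafilter on a Noetherian space contains a set to each point of which it converges. -/
theorem Ultrafilter.exists_mem_forall_le_nhds {X : Type*} [TopologicalSpace X] [NoetherianSpace X]
    (f : Ultrafilter X) : ∃ A ∈ f, ∀ a ∈ A, (f : Filter X) ≤ 𝓝 a := by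
  obtain ⟨A, hA, hmin⟩ := WellFounded.has_min (wellFounded_lt (α := Closeds X))
    {A | (A : Set X) ∈ f} ⟨⊤, univ_mem⟩
  refine ⟨A, hA, fun a ha s hs ↦ ?_⟩
  obtain ⟨t, hts, ht, hat⟩ := mem_nhds_iff.1 hs
  refine mem_of_superset ?_ hts
  by_contra h
  have h' : tᶜ ∈ f := Ultrafilter.compl_mem_iff_notMem.2 h
  refine hmin (A ⊓ ⟨tᶜ, ht.isClosed_compl⟩) (inter_mem hA h') (inf_lt_left.2 fun hle ↦ ?_)
  exact hle ha hat

instance TopologicalSpace.NoetherianSpace.prod {X Y : Type*} [TopologicalSpace X]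
    [TopologicalSpace Y] [NoetherianSpace X] [NoetherianSpace Y] : NoetherianSpace (X × Y) := by
  refine noetherianSpace_iff_isCompact.2 fun s ↦ isCompact_iff_ultrafilter_le_nhds.2 fun f hf ↦ ?_
  obtain ⟨A, hA, hfA⟩ := (f.map Prod.fst).exists_mem_forall_le_nhds
  obtain ⟨B, hB, hfB⟩ := (f.map Prod.snd).exists_mem_forall_le_nhds
  obtain ⟨⟨a, b⟩, hs, ha, hb⟩ :=
    f.nonempty_of_mem (inter_mem (le_principal_iff.1 hf) (inter_mem hA hB))
  refine ⟨(a, b), hs, ?_⟩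
  rw [nhds_prod_eq]
  exact le_prod.2 ⟨hfA a ha, hfB b hb⟩

theorem smul_mem_irreducibleComponents {G X : Type*} [Group G] [TopologicalSpace X] [MulAction G X]
    [ContinuousConstSMul G X] (g : G) {C : Set X} (hC : C ∈ irreducibleComponents X) :
    g • C ∈ irreducibleComponents X := by
  rw [← Set.preimage_smul_inv]
  refine preimage_mem_irreducibleComponents hC (Homeomorph.smul g⁻¹).isOpenEmbedding ?_
  obtain ⟨x, hx⟩ := hC.1.nonempty
  exact ⟨x, hx, (Homeomorph.smul g⁻¹).surjective x⟩

/-- The complement of the closures of the nowhere dense images under `f` of the irreducible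
components of the source. -/
def nowhereDenseImagesCompl {X Y : Type*} [TopologicalSpace X] [TopologicalSpace Y] (f : X → Y) :
    Set Y :=
  ⋂ C ∈ {C | C ∈ irreducibleComponents X ∧ IsNowhereDense (f '' C)}, (closure (f '' C))ᶜ

section nowhereDenseImagesCompl

variable {X Y : Type*} [TopologicalSpace X] [TopologicalSpace Y]

theorem isOpen_nowhereDenseImagesCompl [NoetherianSpace X] (f : X → Y) :
    IsOpen (nowhereDenseImagesCompl f) :=
  (NoetherianSpace.finite_irreducibleComponents.subset fun _ h ↦ h.1).isOpen_biInter
    fun _ _ ↦ isClosed_closure.isOpen_compl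

theorem dense_nowhereDenseImagesCompl [NoetherianSpace X] (f : X → Y) :
    Dense (nowhereDenseImagesCompl f) := by
  rw [nowhereDenseImagesCompl, ← Set.sInter_image]
  refine ((NoetherianSpace.finite_irreducibleComponents.subset fun _ h ↦ h.1).image _).dense_sInter
    (Set.forall_mem_image.2 fun _ _ ↦ isClosed_closure.isOpen_compl)
    (Set.forall_mem_image.2 fun _ h ↦ interior_eq_empty_iff_dense_compl.1 h.2)

theorem apply_notMem_nowhereDenseImagesCompl {f : X → Y} {C : Set X}
    (hC : C ∈ irreducibleComponents X) (hf : IsNowhereDense (f '' C)) {x : X} (hx : x ∈ C) :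
    f x ∉ nowhereDenseImagesCompl f := fun h ↦
  Set.mem_iInter₂.1 h C ⟨hC, hf⟩ (subset_closure (Set.mem_image_of_mem f hx))

theorem smul_nowhereDenseImagesCompl {G : Type*} [Group G] [MulAction G X] [MulAction G Y]
    [ContinuousConstSMul G X] [ContinuousConstSMul G Y] {f : X → Y}
    (hf : ∀ (g : G) x, f (g • x) = g • f x) (g : G) :
    g • nowhereDenseImagesCompl f = nowhereDenseImagesCompl f := by
  have himage (g : G) (C : Set X) : f '' (g • C) = g • f '' C := Set.image_smul_comm f g C (hf g)
  have hsub (g : G) : nowhereDenseImagesCompl f ⊆ g • nowhereDenseImagesCompl f := by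
    intro y hy
    rw [Set.mem_smul_set_iff_inv_smul_mem]
    refine Set.mem_iInter₂.2 fun C hC hyC ↦ ?_
    refine Set.mem_iInter₂.1 hy (g • C) ⟨smul_mem_irreducibleComponents g hC.1, ?_⟩ ?_
    · rw [himage, IsNowhereDense, closure_smul, interior_smul, hC.2, Set.smul_set_empty]
    · rwa [himage, closure_smul, Set.mem_smul_set_iff_inv_smul_mem]
  refine (Set.smul_set_subset_iff_subset_inv_smul_set.2 (hsub g⁻¹)).antisymm (hsub g)

end nowhereDenseImagesCompl

/-- The pairs of points no translate of which lies in `X ×ˢ X`. -/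
def neverBothMem (G : Type*) {Y : Type*} [Group G] [MulAction G Y] (X : Set Y) :
    SubMulAction G (Y × Y) where
  carrier := {p | ∀ g : G, g • p.1 ∈ X → g • p.2 ∉ X}
  smul_mem' h p hp g := by simpa [mul_smul] using hp (g * h)

theorem stmt_0 {G Y : Type*} [Group G] [TopologicalSpace Y]
    [TopologicalSpace.NoetherianSpace Y] [MulAction G Y] [ContinuousConstSMul G Y]
    (X : Set Y) (hXopen : IsOpen X) (hXdense : Dense X) :
    ∃ U : Set Y, IsOpen U ∧ Dense U ∧ (∀ g : G, g • U = U) ∧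
      ∀ x ∈ U, ∀ y ∈ U, ∃ g : G, g • x ∈ X ∧ g • y ∈ X := by
  let W := neverBothMem G X
  let p : W → Y := fun w ↦ w.1.1
  let q : W → Y := fun w ↦ w.1.2
  have hp : Continuous p := continuous_fst.comp continuous_subtype_val
  have hq : Continuous q := continuous_snd.comp continuous_subtype_val
  have : NoetherianSpace W := NoetherianSpace.set (W : Set (Y × Y))
  have : ContinuousConstSMul G W :=
    ⟨fun g ↦ (continuous_subtype_val.const_smul g).subtype_mk _⟩
  have hX : IsNowhereDense Xᶜ :=
    (isClosed_isNowhereDense_iff_compl.2 (by simpa using ⟨hXopen, hXdense⟩)).2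
  refine ⟨nowhereDenseImagesCompl p ∩ nowhereDenseImagesCompl q,
    (isOpen_nowhereDenseImagesCompl p).inter (isOpen_nowhereDenseImagesCompl q),
    (dense_nowhereDenseImagesCompl p).inter_of_isOpen_left (dense_nowhereDenseImagesCompl q)
      (isOpen_nowhereDenseImagesCompl p), fun g ↦ ?_, fun x hx y hy ↦ ?_⟩
  · rw [Set.smul_set_inter, smul_nowhereDenseImagesCompl (fun _ _ ↦ rfl),
      smul_nowhereDenseImagesCompl (fun _ _ ↦ rfl)]
  · by_contra! h
    let w : W := ⟨(x, y), h⟩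
    have hC := irreducibleComponent_mem_irreducibleComponents w
    have hcover : irreducibleComponent w ⊆ p ⁻¹' Xᶜ ∪ q ⁻¹' Xᶜ := fun v _ ↦ by
      have := v.2 1
      simp only [one_smul] at this
      exact not_or_of_imp this
    rcases isPreirreducible_iff_isClosed_union_isClosed.1 hC.1.2 _ _
      (hXopen.isClosed_compl.preimage hp) (hXopen.isClosed_compl.preimage hq) hcover with hZ | hZ
    · exact apply_notMem_nowhereDenseImagesCompl hC (hX.mono (Set.image_subset_iff.2 hZ))
        mem_irreducibleComponent hx.1
    · exact apply_notMem_nowhereDenseImagesCompl hC (hX.mono (Set.image_subset_iff.2 hZ))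
        mem_irreducibleComponent hy.2
end

section
/- (B. H. Neumann's lemma) Let G be a group and E a G-set. Let F be a finite subset of E that does not meet any finite G-orbit in E. Then there exists g ∈ G such that F ∩ (g • F) is empty. -/
open Pointwise

/-- B. H. Neumann's lemma: if `F` is a finite subset of a `G`-set `E` not
meeting any finite `G`-orbit, then there exists `g ∈ G` with `F ∩ g • F = ∅`. -/
theorem stmt_1 {G E : Type*} [Group G] [MulAction G E]
    (F : Set E) (hF : F.Finite)
    (horb : ∀ x ∈ F, (MulAction.orbit G x).Infinite) :
    ∃ g : G, F ∩ g • F = ∅ := by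
  classical
  by_contra! h
  let P : Finset (E × E) :=
    (hF.toFinset ×ˢ hF.toFinset).filter fun p => ∃ t : G, t • p.1 = p.2
  -- a transporter from `p.1` to `p.2`, whenever one exists
  let t : E × E → G := fun p => Classical.epsilon fun g => g • p.1 = p.2
  have hcover : ⋃ p ∈ P, t p • (MulAction.stabilizer G p.1 : Set G) = Set.univ := by
    refine Set.eq_univ_of_forall fun g => ?_
    obtain ⟨y, hy, x, hx, hxy⟩ := h g
    have hg : ∃ t : G, t • x = y := ⟨g, hxy⟩
    refine Set.mem_biUnion (x := (x, y)) ?_ ?_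
    · exact Finset.mem_coe.2 <| Finset.mem_filter.2
        ⟨Finset.mem_product.2 ⟨hF.mem_toFinset.2 hx, hF.mem_toFinset.2 hy⟩, hg⟩
    · have ht : t (x, y) • x = y := Classical.epsilon_spec hg
      rw [mem_leftCoset_iff, SetLike.mem_coe, MulAction.mem_stabilizer_iff, mul_smul,
        inv_smul_eq_iff, ht]
      exact hxy
  obtain ⟨p, hp, hfin⟩ := Subgroup.exists_finiteIndex_of_leftCoset_cover hcover
  have hpF : p.1 ∈ F :=
    hF.mem_toFinset.1 (Finset.mem_product.1 (Finset.mem_filter.1 hp).1).1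
  refine hfin.index_ne_zero ?_
  rw [MulAction.index_stabilizer]
  exact (horb p.1 hpF).ncard
end

section
/- Let G be a group and E a G-set. Let X be a subset of E such that E ∖ X is finite and E ∖ X does not meet any finite G-orbit in E. Then there exists g ∈ G such that X ∪ (g • X) = E. -/
open Pointwise

/-- If every element of `G` moves some point of the finite set `A` into `A`, then some point of `A`
has a finite orbit. -/
theorem MulAction.exists_finite_orbit_of_forall_exists_smul_mem {G E : Type*} [Group G]
    [MulAction G E] {A : Set E} (hA : A.Finite) (h : ∀ g : G, ∃ x ∈ A, g • x ∈ A) :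
    ∃ x ∈ A, (MulAction.orbit G x).Finite := by
  classical
  have hrep : ∀ p : E × E, ∃ g : G, p.2 ∈ MulAction.orbit G p.1 → g • p.1 = p.2 := by
    intro p
    by_cases hp : p.2 ∈ MulAction.orbit G p.1
    · obtain ⟨g, hg⟩ := hp
      exact ⟨g, fun _ => hg⟩
    · exact ⟨1, fun hp' => absurd hp' hp⟩
  choose r hr using hrep
  have hcover : ⋃ p ∈ hA.toFinset ×ˢ hA.toFinset,
      r p • (MulAction.stabilizer G p.1 : Set G) = Set.univ := by
    refine Set.eq_univ_of_forall fun g => ?_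
    obtain ⟨x, hx, hgx⟩ := h g
    refine Set.mem_biUnion (x := (x, g • x)) (by simp [hx, hgx]) ?_
    rw [mem_leftCoset_iff, SetLike.mem_coe, MulAction.mem_stabilizer_iff, mul_smul,
      inv_smul_eq_iff]
    exact (hr (x, g • x) ⟨g, rfl⟩).symm
  obtain ⟨p, hp, hfin⟩ := Subgroup.exists_finiteIndex_of_leftCoset_cover hcover
  refine ⟨p.1, by simpa using (Finset.mem_product.mp hp).1, ?_⟩
  have : Finite (G ⧸ MulAction.stabilizer G p.1) := Subgroup.finite_quotient_of_finiteIndex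
  exact Finite.of_equiv _ (MulAction.orbitEquivQuotientStabilizer G p.1).symm

/-- If `X ⊆ E` has finite complement and `E ∖ X` meets no finite `G`-orbit,
then there exists `g ∈ G` with `X ∪ g • X = E`. -/
theorem stmt_2 {G E : Type*} [Group G] [MulAction G E]
    (X : Set E) (hX : Xᶜ.Finite)
    (horb : ∀ x ∈ Xᶜ, (MulAction.orbit G x).Infinite) :
    ∃ g : G, X ∪ g • X = Set.univ := by
  by_contra! hne
  obtain ⟨x, hx, hfin⟩ :=
    MulAction.exists_finite_orbit_of_forall_exists_smul_mem (G := G) hX fun g => by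
      obtain ⟨x, hx⟩ := (Set.ne_univ_iff_exists_notMem _).mp (hne g⁻¹)
      rw [Set.mem_union, not_or, Set.mem_inv_smul_set_iff] at hx
      exact ⟨x, hx⟩
  exact horb x hx hfin
end

section
/- Let k be a field and let X be a scheme over k such that any two points of X belong to a common open subscheme U of X for which the structure morphism U → Spec k is separated. Then the structure morphism X → Spec k is separated. -/
open AlgebraicGeometry CategoryTheory

section Diagonal

open Limits

/-- For a monomorphism `i : U ⟶ X`, the diagonal of `U` over `S` is the base change of the
diagonal of `X` over `S` along `U ×[S] U ⟶ X ×[S] X`. -/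
theorem CategoryTheory.Limits.isPullback_diagonal_of_mono {C : Type*} [Category C]
    [HasPullbacks C] {U X S : C} (i : U ⟶ X) (f : X ⟶ S) [Mono i] :
    IsPullback i (pullback.diagonal (i ≫ f)) (pullback.diagonal f)
      (pullback.map (i ≫ f) (i ≫ f) f f i i (𝟙 S) (by simp) (by simp)) := by
  have hfst : pullback.map (i ≫ f) (i ≫ f) f f i i (𝟙 S) (by simp) (by simp) ≫
      pullback.fst f f = pullback.fst _ _ ≫ i := pullback.lift_fst _ _ _
  have hsnd : pullback.map (i ≫ f) (i ≫ f) f f i i (𝟙 S) (by simp) (by simp) ≫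
      pullback.snd f f = pullback.snd _ _ ≫ i := pullback.lift_snd _ _ _
  refine ⟨⟨by ext <;> simp [hfst, hsnd]⟩, ⟨PullbackCone.IsLimit.mk _
    (fun s ↦ s.snd ≫ pullback.fst _ _) (fun s ↦ ?_) (fun s ↦ ?_) (fun s m _ h ↦ ?_)⟩⟩
  · simpa [hfst] using (s.condition =≫ pullback.fst _ _).symm
  · have h₁ := s.condition =≫ pullback.fst _ _
    have h₂ := s.condition =≫ pullback.snd _ _
    simp only [Category.assoc, pullback.diagonal_fst, pullback.diagonal_snd, Category.comp_id,
      hfst, hsnd] at h₁ h₂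
    ext
    · simp
    · simp [← cancel_mono i, ← h₁, ← h₂]
  · simp [← h]

end Diagonal

/-- A morphism `f : X ⟶ S` is separated if any two points of `X` with the same image in `S` lie in
a common open subscheme which is separated over `S`. -/
theorem AlgebraicGeometry.IsSeparated.of_forall_exists_opens {X S : Scheme.{u}} (f : X ⟶ S)
    (h : ∀ x y : X, f x = f y → ∃ U : X.Opens, x ∈ U ∧ y ∈ U ∧ IsSeparated (U.ι ≫ f)) :
    IsSeparated f := by
  refine ⟨IsZariskiLocalAtTarget.of_forall_exists_morphismRestrict fun z ↦ ?_⟩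
  obtain ⟨U, hx, hy, hU⟩ := h (Limits.pullback.fst f f z) (Limits.pullback.snd f f z) (by
    rw [← Scheme.Hom.comp_apply, ← Scheme.Hom.comp_apply, Limits.pullback.condition])
  let g := Limits.pullback.map (U.ι ≫ f) (U.ι ≫ f) f f U.ι U.ι (𝟙 S) (by simp) (by simp)
  have hg : IsPullback U.ι (Limits.pullback.diagonal (U.ι ≫ f)) (Limits.pullback.diagonal f) g :=
    Limits.isPullback_diagonal_of_mono U.ι f
  refine ⟨g.opensRange, ?_, ?_⟩
  · change z ∈ Set.range g
    rw [Scheme.Pullback.range_map]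
    simpa using ⟨hx, hy⟩
  · rw [MorphismProperty.arrow_mk_iso_iff @IsClosedImmersion (morphismRestrictOpensRange _ g),
      ← MorphismProperty.cancel_left_of_respectsIso @IsClosedImmersion hg.isoPullback.hom,
      hg.isoPullback_hom_snd]
    infer_instance

/-- Let `X` be a scheme over a field `k` such that any two points of `X` lie in a
common open subscheme whose structure morphism to `Spec k` is separated. Then
the structure morphism of `X` is separated. -/
theorem stmt_3 {k : Type u} [Field k] (X : Scheme.{u})
    (f : X ⟶ Spec (CommRingCat.of k))
    (h : ∀ x y : X, ∃ U : X.Opens, x ∈ U ∧ y ∈ U ∧ IsSeparated (U.ι ≫ f)) :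
    IsSeparated f :=
  .of_forall_exists_opens f fun x y _ ↦ h x y
end

section
/- Let G be a group and E a G-set. If a subset X ⊆ E is G-transfixed above, then there exists a finite subset F ⊆ E such that X ∖ F is finely G-transfixed above, i.e., there exists a G-invariant subset Y ⊆ E with X ∖ F ⊆ Y, Y ∖ (X ∖ F) finite, and Y ∖ (X ∖ F) meeting no finite G-orbit of E. -/
open Pointwise

/-- If `X ⊆ E` is `G`-transfixed above, then there is a finite subset `F ⊆ E`
such that `X ∖ F` is finely `G`-transfixed above. -/
theorem stmt_7 {G E : Type*} [Group G] [MulAction G E] (X : Set E)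
    (h : ∃ Y : Set E, (∀ g : G, g • Y = Y) ∧ X ⊆ Y ∧ (Y \ X).Finite) :
    ∃ F : Set E, F.Finite ∧
      ∃ Y : Set E, (∀ g : G, g • Y = Y) ∧ X \ F ⊆ Y ∧ (Y \ (X \ F)).Finite ∧
        ∀ e ∈ Y \ (X \ F), (MulAction.orbit G e).Infinite := by
  obtain ⟨Y, hY, hXY, hfin⟩ := h
  set S : Set E := {e ∈ Y \ X | (MulAction.orbit G e).Finite}
  set B : Set E := ⋃ e ∈ S, MulAction.orbit G e with hB
  have hBfin : B.Finite := (hfin.subset fun e he => he.1).biUnion fun e he => he.2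
  have hBinv (g : G) : g • B = B := by
    simp only [hB, Set.smul_set_iUnion₂, MulAction.smul_orbit]
  have hsub : (Y \ B) \ (X \ B) ⊆ Y \ X :=
    fun e he => ⟨he.1.1, fun hX => he.2 ⟨hX, he.1.2⟩⟩
  refine ⟨B, hBfin, Y \ B, fun g => by rw [Set.smul_set_sdiff, hY, hBinv],
    Set.sdiff_subset_sdiff_left hXY, hfin.subset hsub, fun e he horb => he.1.2 ?_⟩
  exact Set.mem_biUnion (show e ∈ S from ⟨hsub he, horb⟩) (MulAction.mem_orbit_self e)
end

section
/- (Abadie, Kellendonk–Lawson: existence of the universal globalization) Let G be a group and let α be a partial action of G on a set X. Then there exist a G-set E and an injective map ι : X → E such that (i) every G-orbit in E meets ι(X), and (ii) for all g ∈ G and all x, y ∈ X, one has (x ∈ D_g and α(g)(x) = y) if and only if g • ι(x) = ι(y). -/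
/-- A partial action of a group `G` on a set `X`: each `g` acts as a bijection
from a domain `D g` onto `D g⁻¹`, via `act g` (whose values off `D g` are
irrelevant). -/
structure PartialAction (G : Type*) [Group G] (X : Type*) where
  /-- the domain of `α(g)` -/
  D : G → Set X
  /-- the partial map `α(g)`, only meaningful on `D g` -/
  act : G → X → X
  D_one : D 1 = Set.univ
  act_one : ∀ x : X, act 1 x = x
  mem_inv : ∀ (g : G) (x : X), x ∈ D g → act g x ∈ D g⁻¹
  act_inv : ∀ (g : G) (x : X), x ∈ D g → act g⁻¹ (act g x) = x
  mem_mul : ∀ (g h : G) (x : X), x ∈ D h → act h x ∈ D g → x ∈ D (g * h)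
  act_mul : ∀ (g h : G) (x : X), x ∈ D h → act h x ∈ D g →
    act (g * h) x = act g (act h x)

namespace PartialAction

variable {G : Type*} {X : Type*} [Group G] (α : PartialAction G X)

/-- The relation `α(g)(x) = y`, including the requirement that `x` lies in the domain. -/
def Rel (g : G) (x y : X) : Prop := x ∈ α.D g ∧ α.act g x = y

variable {α}

lemma rel_one_iff {x y : X} : α.Rel 1 x y ↔ x = y := by
  simp [Rel, α.D_one, α.act_one]

lemma Rel.inv {g : G} {x y : X} (h : α.Rel g x y) : α.Rel g⁻¹ y x := by
  obtain ⟨hx, rfl⟩ := h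
  exact ⟨α.mem_inv g x hx, α.act_inv g x hx⟩

lemma Rel.mul {g h : G} {x y z : X} (hyz : α.Rel g y z) (hxy : α.Rel h x y) :
    α.Rel (g * h) x z := by
  obtain ⟨hx, rfl⟩ := hxy
  obtain ⟨hy, rfl⟩ := hyz
  exact ⟨α.mem_mul g h x hx hy, α.act_mul g h x hx hy⟩

variable (α)

/-- The equivalence relation on `G × X` identifying `(g, x)` with `(h, y)` when
`α(h⁻¹ * g)(x) = y`. -/
def globalizationSetoid : Setoid (G × X) where
  r p q := α.Rel (q.1⁻¹ * p.1) p.2 q.2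
  iseqv :=
    { refl := fun p => by simp [rel_one_iff]
      symm := fun h => by simpa using h.inv
      trans := fun h₁ h₂ => by simpa [mul_assoc] using h₂.mul h₁ }

/-- The universal globalization of a partial action. -/
def Globalization := Quotient α.globalizationSetoid

namespace Globalization

/-- The class of `(g, x)`, to be thought of as `g • x`. -/
def mk (g : G) (x : X) : α.Globalization := Quotient.mk α.globalizationSetoid (g, x)

variable {α}

lemma mk_eq_mk_iff {g h : G} {x y : X} : mk α g x = mk α h y ↔ α.Rel (h⁻¹ * g) x y :=
  Quotient.eq

lemma exists_mk_eq (e : α.Globalization) : ∃ g x, mk α g x = e := by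
  obtain ⟨⟨g, x⟩, rfl⟩ := Quotient.exists_rep e
  exact ⟨g, x, rfl⟩

instance : SMul G α.Globalization where
  smul k := Quotient.lift (fun p => mk α (k * p.1) p.2) fun p q (h : α.Rel _ _ _) =>
    mk_eq_mk_iff.2 <| by simpa [mul_assoc] using h

lemma smul_mk (k g : G) (x : X) : k • mk α g x = mk α (k * g) x := rfl

instance : MulAction G α.Globalization where
  one_smul e := by
    obtain ⟨g, x, rfl⟩ := exists_mk_eq e
    simp [smul_mk]
  mul_smul k l e := by
    obtain ⟨g, x, rfl⟩ := exists_mk_eq e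
    simp [smul_mk, mul_assoc]

end Globalization

end PartialAction

open PartialAction Globalization


/-- Existence of the universal globalization (Abadie, Kellendonk–Lawson):
every partial action of `G` on `X` is the restriction to `X` of a global
`G`-action (here encoded by a homomorphism `ρ : G →* Equiv.Perm E`) on a set
`E ⊇ X` every orbit of which meets `X`. -/
theorem stmt_10 {G : Type u} {X : Type v} [Group G] (α : PartialAction G X) :
    ∃ (E : Type (max u v)) (ρ : G →* Equiv.Perm E) (ι : X → E),
      Function.Injective ι ∧
      (∀ e : E, ∃ (g : G) (x : X), ρ g (ι x) = e) ∧
      (∀ (g : G) (x y : X), (x ∈ α.D g ∧ α.act g x = y) ↔ ρ g (ι x) = ι y) := by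
  refine ⟨α.Globalization, MulAction.toPermHom G α.Globalization, mk α 1, ?_, ?_, ?_⟩
  · intro x y h
    simpa [mk_eq_mk_iff, rel_one_iff] using h
  · intro e
    obtain ⟨g, x, rfl⟩ := exists_mk_eq e
    exact ⟨g, x, by simp [smul_mk]⟩
  · intro g x y
    simp [smul_mk, mk_eq_mk_iff, PartialAction.Rel]
end

section
/- (Uniqueness of the universal globalization) Let G be a group and let α be a partial action of G on a set X. Suppose (E, ι) and (E', ι') are two globalizations of α, i.e., E and E' are G-sets, ι : X → E and ι' : X → E' are injective, every G-orbit in E meets ι(X) and every G-orbit in E' meets ι'(X), and for all g ∈ G and x, y ∈ X one has (x ∈ D_g and α(g)(x) = y) if and only if g • ι(x) = ι(y), and likewise with (E', ι'). Then there exists a G-equivariant bijection φ : E → E' such that φ ∘ ι = ι'. -/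
/-- Uniqueness of the universal globalization: two globalizations of the same
partial action are related by a `G`-equivariant bijection compatible with the
embeddings of `X`. -/
theorem stmt_11 {G X E E' : Type*} [Group G] [MulAction G E] [MulAction G E']
    (α : PartialAction G X) (ι : X → E) (ι' : X → E')
    (hι : Function.Injective ι) (hι' : Function.Injective ι')
    (horb : ∀ e : E, ∃ (g : G) (x : X), g • ι x = e)
    (horb' : ∀ e : E', ∃ (g : G) (x : X), g • ι' x = e)
    (hres : ∀ (g : G) (x y : X), (x ∈ α.D g ∧ α.act g x = y) ↔ g • ι x = ι y)
    (hres' : ∀ (g : G) (x y : X), (x ∈ α.D g ∧ α.act g x = y) ↔ g • ι' x = ι' y) :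
    ∃ φ : E → E', Function.Bijective φ ∧
      (∀ (g : G) (e : E), φ (g • e) = g • φ e) ∧ φ ∘ ι = ι' := by
  have key (g h : G) (x y : X) : g • ι x = h • ι y ↔ g • ι' x = h • ι' y := by
    rw [← inv_smul_eq_iff, smul_smul, ← hres, hres', ← smul_smul, inv_smul_eq_iff]
  choose g x hgx using horb
  have hφ (h : G) (y : X) : g (h • ι y) • ι' (x (h • ι y)) = h • ι' y :=
    (key _ _ _ _).mp (hgx _)
  refine ⟨fun e => g e • ι' (x e), ⟨fun a b hab => ?_, fun e' => ?_⟩, fun h e => ?_, ?_⟩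
  · rw [← hgx a, ← hgx b]
    exact (key _ _ _ _).mpr hab
  · obtain ⟨h, y, rfl⟩ := horb' e'
    exact ⟨h • ι y, hφ h y⟩
  · have := hφ (h * g e) (x e)
    rwa [← smul_smul, hgx, ← smul_smul] at this
  · funext y
    simpa using hφ 1 y
end

section
/- Let G be a group with Property FW, let E be a G-set, and let X ⊆ E be a G-commensurated subset. Then there exist a finite subset L ⊆ E and an element g ∈ G such that (X ∖ L) ∪ g • (X ∖ L) is a G-invariant subset of E. -/
open Pointwise

universe u v

/-- A group `G` has Property FW if for every `G`-set `E` (encoded by a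
homomorphism `ρ : G →* Equiv.Perm E`) and every `G`-commensurated subset
`X ⊆ E`, the subset `X` is `G`-transfixed. -/
def HasPropertyFW (G : Type u) [Group G] : Prop :=
  ∀ (E : Type v) (ρ : G →* Equiv.Perm E) (X : Set E),
    (∀ g : G, (X \ (ρ g⁻¹) '' X).Finite) →
    ∃ Y : Set E, (∀ g : G, (ρ g) '' Y = Y) ∧ (symmDiff X Y).Finite

/-- **Neumann's separation lemma**: a finite set all of whose points have infinite orbits
can be moved off itself. -/
theorem MulAction.exists_disjoint_smul_of_infinite_orbit {G α : Type*} [Group G] [MulAction G α]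
    {F : Set α} (hF : F.Finite) (horb : ∀ x ∈ F, (MulAction.orbit G x).Infinite) :
    ∃ g : G, Disjoint F (g • F) := by
  by_contra! h
  have hk : ∀ p : α × α, ∃ k : G, (∃ g : G, g • p.1 = p.2) → k • p.1 = p.2 := fun p => by
    by_cases hp : ∃ g : G, g • p.1 = p.2
    · exact hp.imp fun g hg _ => hg
    · exact ⟨1, fun h => (hp h).elim⟩
  choose k hk using hk
  have hcover : ⋃ p ∈ (hF.prod hF).toFinset,
      k p • (MulAction.stabilizer G p.1 : Set G) = Set.univ := by
    refine Set.eq_univ_of_forall fun g => ?_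
    obtain ⟨_, hy, x, hx, rfl⟩ := Set.not_disjoint_iff.mp (h g)
    refine Set.mem_iUnion₂.mpr ⟨(x, g • x), (hF.prod hF).mem_toFinset.mpr ⟨hx, hy⟩, ?_⟩
    rw [mem_leftCoset_iff, SetLike.mem_coe, MulAction.mem_stabilizer_iff, mul_smul,
      inv_smul_eq_iff]
    exact (hk (x, g • x) ⟨g, rfl⟩).symm
  obtain ⟨p, hp, hfin⟩ := Subgroup.exists_finiteIndex_of_leftCoset_cover hcover
  refine horb p.1 ((hF.prod hF).mem_toFinset.mp hp).1 (Set.finite_coe_iff.mp ?_)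
  exact Finite.of_equiv _ (MulAction.orbitEquivQuotientStabilizer G p.1).symm

/-- An invariant set with finitely many points removed becomes, after removing finitely many
finite orbits, the complement of a finite set that can be moved off itself. -/
theorem MulAction.exists_diff_union_smul_diff_eq {G α : Type*} [Group G] [MulAction G α]
    {F Y : Set α} (hF : F.Finite) (hY : ∀ g : G, g • Y = Y) :
    ∃ (B : Set α) (g : G), B.Finite ∧ (∀ h : G, h • (Y \ B) = Y \ B) ∧
      ((Y \ B) \ F) ∪ g • ((Y \ B) \ F) = Y \ B := by
  set B : Set α := ⋃ x ∈ {x ∈ F | (MulAction.orbit G x).Finite}, MulAction.orbit G x with hB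
  have hBfin : B.Finite := (hF.subset (Set.sep_subset _ _)).biUnion fun x hx => hx.2
  have hBinv : ∀ h : G, h • B = B := fun h => by
    simp only [hB, Set.smul_set_iUnion₂, MulAction.smul_orbit]
  have hinv : ∀ h : G, h • (Y \ B) = Y \ B := fun h => by
    rw [Set.smul_set_sdiff, hY, hBinv]
  obtain ⟨g, hg⟩ := MulAction.exists_disjoint_smul_of_infinite_orbit (G := G)
    (hF.inter_of_left (Y \ B)) fun x hx hfin =>
      hx.2.2 (Set.mem_biUnion (show x ∈ {x ∈ F | _} from ⟨hx.1, hfin⟩)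
        (MulAction.mem_orbit_self x))
  refine ⟨B, g, hBfin, hinv, ?_⟩
  rw [← Set.sdiff_inter_self_eq_sdiff (t := F), Set.smul_set_sdiff, hinv, ← Set.sdiff_inter,
    hg.inter_eq, Set.sdiff_empty]

/-- If `G` has Property FW and `X ⊆ E` is `G`-commensurated, then there exist a
finite set `L` and `g ∈ G` such that `(X ∖ L) ∪ g • (X ∖ L)` is `G`-invariant. -/
theorem stmt_13 {G : Type u} [Group G] (hFW : HasPropertyFW.{u, v} G)
    {E : Type v} [MulAction G E] (X : Set E)
    (hX : ∀ g : G, (X \ g⁻¹ • X).Finite) :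
    ∃ (L : Set E) (g : G), L.Finite ∧
      ∀ h : G, h • ((X \ L) ∪ g • (X \ L)) = (X \ L) ∪ g • (X \ L) := by
  obtain ⟨Y, hYinv, hXY⟩ := hFW E (MulAction.toPermHom G E) X hX
  rw [Set.symmDiff_def, Set.finite_union] at hXY
  obtain ⟨B, g, hB, hinv, hg⟩ := MulAction.exists_diff_union_smul_diff_eq hXY.2 hYinv
  have hXL : X \ (X \ Y ∪ B) = (Y \ B) \ (Y \ X) := by
    ext x
    simp only [Set.mem_sdiff, Set.mem_union]
    tauto
  refine ⟨X \ Y ∪ B, g, hXY.1.union hB, fun h => ?_⟩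
  rw [hXL, hg, hinv]
end

section
/- Let G be a group with a topological partial action α on a topological space X (i.e., each domain D_g is open in X and each α(g) : D_g → D_{g⁻¹} is a homeomorphism), and let (E, ι) be a globalization of α, i.e., E is a G-set, ι : X → E is injective, every G-orbit in E meets ι(X), and for all g ∈ G and x, y ∈ X one has (x ∈ D_g and α(g)(x) = y) if and only if g • ι(x) = ι(y). Then there exists a unique topology on E such that ι(X) is open in E, ι is a homeomorphism onto its image, and G acts on E by homeomorphisms. Moreover, if D_g is dense in X for every g ∈ G, then ι(X) is dense in E for this topology. -/
/-- The final topology on a `G`-set `E` for the maps `x ↦ g • ι x`. -/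
abbrev orbitTopology (G : Type*) {X E : Type*} [Group G] [TopologicalSpace X] [MulAction G E]
    (ι : X → E) : TopologicalSpace E :=
  ⨆ g : G, TopologicalSpace.coinduced (fun x => g • ι x) inferInstance

theorem isOpen_orbitTopology_iff {G X E : Type*} [Group G] [TopologicalSpace X] [MulAction G E]
    {ι : X → E} {U : Set E} :
    @IsOpen E (orbitTopology G ι) U ↔ ∀ g : G, IsOpen ((fun x => g • ι x) ⁻¹' U) := by
  simp only [isOpen_iSup_iff, isOpen_coinduced]

/-- If `G` acts by continuous maps, `ι` is an open embedding and every orbit meets the range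
of `ι`, then the topology is the final one for the maps `x ↦ g • ι x`. -/
theorem eq_orbitTopology {G X E : Type*} [Group G] [TopologicalSpace X] [MulAction G E]
    {ι : X → E} (horb : ∀ e : E, ∃ (g : G) (x : X), g • ι x = e) [τ : TopologicalSpace E]
    (hrange : IsOpen (Set.range ι)) (hind : Topology.IsInducing ι)
    (hsmul : ∀ g : G, Continuous (fun e : E => g • e)) :
    τ = orbitTopology G ι := by
  refine TopologicalSpace.ext_iff.2 fun U => ?_
  rw [isOpen_orbitTopology_iff]
  refine ⟨fun hU g => hU.preimage ((hsmul g).comp hind.continuous), fun hU => ?_⟩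
  have hcover : U = ⋃ g : G, (fun e : E => g⁻¹ • e) ⁻¹' (ι '' ((fun x => g • ι x) ⁻¹' U)) := by
    ext e
    simp only [Set.mem_iUnion, Set.mem_preimage, Set.mem_image]
    constructor
    · intro he
      obtain ⟨g, x, rfl⟩ := horb e
      exact ⟨g, x, he, by simp⟩
    · rintro ⟨g, x, hx, hxe⟩
      rwa [hxe, smul_inv_smul] at hx
  rw [hcover]
  exact isOpen_iUnion fun g => (hind.isOpenMap hrange _ (hU g)).preimage (hsmul g⁻¹)

theorem continuous_smul_orbitTopology {G X E : Type*} [Group G] [TopologicalSpace X]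
    [MulAction G E] (ι : X → E) (g : G) :
    @Continuous E E (orbitTopology G ι) (orbitTopology G ι) (fun e => g • e) := by
  let _ := orbitTopology G ι
  refine continuous_def.2 fun U hU => isOpen_orbitTopology_iff.2 fun h => ?_
  simpa only [Set.preimage_preimage, smul_smul] using isOpen_orbitTopology_iff.1 hU (g * h)

theorem isOpenEmbedding_orbitTopology {G X E : Type*} [Group G] [TopologicalSpace X]
    [MulAction G E] (α : PartialAction G X) (hopen : ∀ g : G, IsOpen (α.D g))
    (hcont : ∀ g : G, ContinuousOn (α.act g) (α.D g)) {ι : X → E} (hι : Function.Injective ι)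
    (hres : ∀ (g : G) (x y : X), (x ∈ α.D g ∧ α.act g x = y) ↔ g • ι x = ι y) :
    @Topology.IsOpenEmbedding X E _ (orbitTopology G ι) ι := by
  let _ := orbitTopology G ι
  refine .of_continuous_injective_isOpenMap
    (continuous_def.2 fun U hU => ?_) hι fun V hV => isOpen_orbitTopology_iff.2 fun g => ?_
  · simpa only [one_smul] using isOpen_orbitTopology_iff.1 hU (1 : G)
  · have heq : (fun x => g • ι x) ⁻¹' (ι '' V) = α.D g ∩ α.act g ⁻¹' V := by
      ext x
      constructor
      · rintro ⟨y, hy, hyx⟩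
        obtain ⟨hx, rfl⟩ := (hres g x y).2 hyx.symm
        exact ⟨hx, hy⟩
      · rintro ⟨hx, hy⟩
        exact ⟨α.act g x, hy, ((hres g x _).1 ⟨hx, rfl⟩).symm⟩
    rw [heq]
    exact (hcont g).isOpen_inter_preimage (hopen g) hV

theorem dense_range_of_dense_domains {G X E : Type*} [Group G] [TopologicalSpace X]
    [MulAction G E] [TopologicalSpace E] (α : PartialAction G X) {ι : X → E}
    (horb : ∀ e : E, ∃ (g : G) (x : X), g • ι x = e)
    (hres : ∀ (g : G) (x y : X), (x ∈ α.D g ∧ α.act g x = y) ↔ g • ι x = ι y)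
    (hcont : Continuous ι) (hsmul : ∀ g : G, Continuous (fun e : E => g • e))
    (hdense : ∀ g : G, Dense (α.D g)) : Dense (Set.range ι) := by
  refine dense_iff_inter_open.2 fun U hU => ?_
  rintro ⟨e, he⟩
  obtain ⟨g, x, rfl⟩ := horb e
  obtain ⟨y, hyU, hyD⟩ :=
    (hdense g).inter_open_nonempty _ (hU.preimage ((hsmul g).comp hcont)) ⟨x, he⟩
  exact ⟨g • ι y, hyU, α.act g y, ((hres g y _).1 ⟨hyD, rfl⟩).symm⟩

/-- Let `α` be a topological partial action of `G` on a topological space `X`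
(all domains `D g` open and each `α(g)` continuous on `D g`; together with the
partial-action axioms this makes each `α(g) : D g → D g⁻¹` a homeomorphism),
and let `(E, ι)` be a globalization of `α`. Then there is a unique topology on
`E` making `ι(X)` open, `ι` a homeomorphism onto its image, and the `G`-action
an action by homeomorphisms. Moreover, if every `D g` is dense in `X`, then
`ι(X)` is dense in `E` for this topology. -/
theorem stmt_14 {G X E : Type*} [Group G] [TopologicalSpace X] [MulAction G E]
    (α : PartialAction G X)
    (hopen : ∀ g : G, IsOpen (α.D g))
    (hcont : ∀ g : G, ContinuousOn (α.act g) (α.D g))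
    (ι : X → E) (hι : Function.Injective ι)
    (horb : ∀ e : E, ∃ (g : G) (x : X), g • ι x = e)
    (hres : ∀ (g : G) (x y : X), (x ∈ α.D g ∧ α.act g x = y) ↔ g • ι x = ι y) :
    (∃! τ : TopologicalSpace E,
        @IsOpen E τ (Set.range ι) ∧ @Topology.IsInducing X E _ τ ι ∧
        ∀ g : G, @Continuous E E τ τ (fun e => g • e)) ∧
    ((∀ g : G, Dense (α.D g)) →
      ∀ τ : TopologicalSpace E,
        (@IsOpen E τ (Set.range ι) ∧ @Topology.IsInducing X E _ τ ι ∧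
          ∀ g : G, @Continuous E E τ τ (fun e => g • e)) →
        @Dense E τ (Set.range ι)) := by
  refine ⟨⟨orbitTopology G ι, ?_, ?_⟩, ?_⟩
  · let _ := orbitTopology G ι
    have hemb := isOpenEmbedding_orbitTopology α hopen hcont hι hres
    exact ⟨hemb.isOpen_range, hemb.isInducing, continuous_smul_orbitTopology ι⟩
  · rintro τ ⟨hrange, hind, hsmul⟩
    exact eq_orbitTopology horb hrange hind hsmul
  · rintro hdense τ ⟨-, hind, hsmul⟩
    exact dense_range_of_dense_domains α horb hres hind.continuous hsmul hdense
end
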